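/- Suppose Assumptions 1, 2, 3 hold for the lower-level problem P(x) and that f : ℝ^{d_x}×ℝ^{d_y} → ℝ is twice continuously differentiable, and set Φ(x) := f(x, y*(x)). Fix x⁰ ∈ ℝ^{d_x} and ε > 0. Then: (i) the functions Φ, λ_j(·), and x ↦ p_j(x, y*(x)) (for each j) are Lipschitz on the closed ball B(x⁰, ε), with Lipschitz constants l_Φ(x⁰,ε), l_{λ_j}(x⁰,ε), l_{p_j}(x⁰,ε); (ii) if moreover the SCSC holds at y*(x⁰) with respect to λ(x⁰) and there exists ε₁ > 0 such that λ_j(x⁰) > l_{λ_j}(x⁰,ε₁)·ε₁ for all j ∈ J(x⁰) and p_j(x⁰, y*(x⁰)) < −l_{p_j}(x⁰,ε₁)·ε₁ for all j ∉ J(x⁰), then y* is continuously differentiable on B(x⁰, ε₁). -/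

import Mathlib

open Topology Filter

/-- Tangent inequality for a differentiable convex function on a normed space. -/
theorem ConvexOn.add_fderiv_le {F : Type*} [NormedAddCommGroup F] [NormedSpace ℝ F]
    {φ : F → ℝ} (hφ : ConvexOn ℝ Set.univ φ) {y : F} (hd : DifferentiableAt ℝ φ y) (z : F) :
    φ y + fderiv ℝ φ y (z - y) ≤ φ z := by
  have hline : HasDerivAt (fun t : ℝ => φ (y + t • (z - y))) (fderiv ℝ φ y (z - y)) 0 := by
    have h0 : HasDerivAt (fun t : ℝ => y + t • (z - y)) (z - y) 0 := by
      simpa using ((hasDerivAt_id (0 : ℝ)).smul_const (z - y)).const_add y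
    have h1 : HasFDerivAt φ (fderiv ℝ φ y) (y + (0 : ℝ) • (z - y)) := by
      simpa using hd.hasFDerivAt
    exact h1.comp_hasDerivAt 0 h0
  have hconv : ConvexOn ℝ Set.univ (fun t : ℝ => φ (y + t • (z - y))) := by
    have := hφ.comp_affineMap (AffineMap.lineMap y z : ℝ →ᵃ[ℝ] F)
    refine this.congr fun t _ => ?_
    simp [AffineMap.lineMap_apply, add_comm]
  have := hconv.le_slope_of_hasDerivAt (Set.mem_univ 0) (Set.mem_univ 1) one_pos hline
  simp only [slope_def_field, one_smul, zero_smul, add_zero, add_sub_cancel, sub_zero,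
    div_one] at this
  linarith

/-- First-order lower bound with quadratic growth for a differentiable strongly convex function. -/
theorem ConvexOn.add_half_mul_sq_le {F : Type*} [NormedAddCommGroup F] [InnerProductSpace ℝ F]
    {φ : F → ℝ} {μ : ℝ} (hφ : ConvexOn ℝ Set.univ fun y => φ y - μ / 2 * ‖y‖ ^ 2) {u : F}
    (hd : DifferentiableAt ℝ φ u) (v : F) :
    φ u + fderiv ℝ φ u (v - u) + μ / 2 * ‖v - u‖ ^ 2 ≤ φ v := by
  have hsq : HasFDerivAt (fun y : F => μ / 2 * ‖y‖ ^ 2) ((μ / 2) • (2 • innerSL ℝ u)) u :=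
    (hasStrictFDerivAt_norm_sq u).hasFDerivAt.const_mul _
  have hsub := hd.hasFDerivAt.fun_sub hsq
  have h1 := hφ.add_fderiv_le hsub.differentiableAt v
  rw [hsub.fderiv] at h1
  simp only [sub_apply, smul_apply, innerSL_apply_apply, smul_eq_mul, nsmul_eq_mul, inner_sub_right,
    real_inner_self_eq_norm_sq] at h1
  have h2 := norm_sub_sq_real v u
  rw [real_inner_comm] at h2
  rw [h2]
  push_cast at h1
  linarith

section LinearAlgebra

variable {F ι : Type*} [NormedAddCommGroup F] [NormedSpace ℝ F] [Fintype ι]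

/-- Linearly independent functionals attain prescribed values. -/
theorem LinearIndepOn.exists_apply_eq {V : ι → F →L[ℝ] ℝ} {K : Set ι}
    (h : LinearIndepOn ℝ V K) (s : ι → ℝ) : ∃ d : F, ∀ k ∈ K, V k d = s k := by
  have h' : LinearIndependent ℝ (fun k : K => (V k : F → ℝ)) :=
    LinearIndependent.map' h
      (({ toFun := fun T => ⇑T, map_add' := fun _ _ => rfl, map_smul' := fun _ _ => rfl } :
        (F →L[ℝ] ℝ) →ₗ[ℝ] (F → ℝ)))
      (LinearMap.ker_eq_bot.2 DFunLike.coe_injective)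
  rw [← span_flip_eq_top_iff_linearIndependent] at h'
  let T : F →ₗ[ℝ] (K → ℝ) := LinearMap.pi fun k => (V k : F →ₗ[ℝ] ℝ)
  have hT : LinearMap.range T = ⊤ := by
    rw [← h', ← Submodule.span_eq (LinearMap.range T)]
    rfl
  obtain ⟨d, hd⟩ := LinearMap.range_eq_top.1 hT fun k => s k
  exact ⟨d, fun k hk => congrFun hd ⟨k, hk⟩⟩

/-- Coefficients of combinations of linearly independent functionals are controlled by the norm of
the combination, uniformly near the given functionals. -/
theorem LinearIndepOn.eventually_sum_abs_le {V₀ : ι → F →L[ℝ] ℝ} {K : Set ι}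
    (h : LinearIndepOn ℝ V₀ K) :
    ∃ M : ℝ, 0 ≤ M ∧ ∀ᶠ V in 𝓝 V₀, ∀ a : ι → ℝ, (∀ k ∉ K, a k = 0) →
      ∑ k, |a k| ≤ M * ‖∑ k, a k • V k‖ := by
  classical
  choose d hd using fun l : ι => h.exists_apply_eq (Pi.single l 1)
  have hcont : Continuous fun V : ι → F →L[ℝ] ℝ => ∑ l, ∑ k, |V k (d l) - V₀ k (d l)| := by
    fun_prop
  have hsmall : ∀ᶠ V in 𝓝 V₀, ∑ l, ∑ k, |V k (d l) - V₀ k (d l)| < 1 / 2 :=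
    hcont.continuousAt.eventually_lt continuousAt_const (by simp)
  refine ⟨2 * ∑ l, ‖d l‖, by positivity, hsmall.mono fun V hV a ha => ?_⟩
  have hcoord : ∀ l, |a l| ≤ ‖∑ k, a k • V k‖ * ‖d l‖
      + (∑ k, |V k (d l) - V₀ k (d l)|) * ∑ k, |a k| := by
    intro l
    by_cases hl : l ∈ K
    · have h0 : ∑ k, a k * V₀ k (d l) = a l := by
        rw [Finset.sum_eq_single l]
        · simp [hd l l hl]
        · intro k _ hkl
          by_cases hk : k ∈ K
          · simp [hd l k hk, hkl]
          · simp [ha k hk]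
        · simp
      have h1 : a l = (∑ k, a k • V k) (d l) - ∑ k, a k * (V k (d l) - V₀ k (d l)) := by
        simp [mul_sub, Finset.sum_sub_distrib, h0]
      have h2 : |(∑ k, a k • V k) (d l)| ≤ ‖∑ k, a k • V k‖ * ‖d l‖ :=
        (∑ k, a k • V k).le_opNorm (d l)
      have h3 : |∑ k, a k * (V k (d l) - V₀ k (d l))|
          ≤ (∑ k, |V k (d l) - V₀ k (d l)|) * ∑ k, |a k| := by
        refine (Finset.abs_sum_le_sum_abs _ _).trans ?_
        rw [Finset.sum_mul]
        refine Finset.sum_le_sum fun k hk => ?_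
        rw [abs_mul, mul_comm]
        gcongr
        exact Finset.single_le_sum (f := fun k => |a k|) (fun i _ => abs_nonneg (a i)) hk
      calc |a l| = _ := congrArg abs h1
        _ ≤ _ := abs_sub _ _
        _ ≤ _ := add_le_add h2 h3
    · rw [ha l hl, abs_zero]
      positivity
  have hsum := Finset.sum_le_sum fun l (_ : l ∈ Finset.univ) => hcoord l
  rw [Finset.sum_add_distrib, ← Finset.mul_sum, ← Finset.sum_mul] at hsum
  have hA : 0 ≤ ∑ k, |a k| := by positivity
  nlinarith [mul_le_mul_of_nonneg_right hV.le hA]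

end LinearAlgebra

/-- A parametric program with `C²` data, `μ`-strongly convex objective `g x`, and constraint
functions `c k x` with multipliers `w x k`, together with its family of KKT points `y`.
Inequality and equality constraints are treated uniformly: `con_lower` holds for convex functions
with nonnegative multipliers and for affine functions with arbitrary ones, while `compl` and `cross`
express complementarity, feasibility and the sign condition on the multipliers. -/
structure IsKKTFamily {E F ι : Type*} [NormedAddCommGroup E] [NormedSpace ℝ E]
    [NormedAddCommGroup F] [NormedSpace ℝ F] [Fintype ι] (g : E → F → ℝ) (c : ι → E → F → ℝ)
    (μ : ℝ) (y : E → F) (w : E → ι → ℝ) : Prop where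
  contDiff_obj : ContDiff ℝ 2 (Function.uncurry g)
  contDiff_con : ∀ k, ContDiff ℝ 2 (Function.uncurry (c k))
  pos : 0 < μ
  obj_lower : ∀ x u v, g x u + fderiv ℝ (g x) u (v - u) + μ / 2 * ‖v - u‖ ^ 2 ≤ g x v
  con_lower : ∀ x x' k u v,
    w x' k * fderiv ℝ (c k x) u (v - u) ≤ w x' k * (c k x v - c k x u)
  stationary : ∀ x, fderiv ℝ (g x) (y x) + ∑ k, w x k • fderiv ℝ (c k x) (y x) = 0
  compl : ∀ x k, w x k * c k x (y x) = 0
  cross : ∀ x x' k, w x k * c k x' (y x') ≤ 0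
  licq : ∀ x, LinearIndepOn ℝ (fun k => fderiv ℝ (c k x) (y x)) {k | c k x (y x) = 0}

namespace IsKKTFamily

variable {E F ι : Type*} [NormedAddCommGroup E] [NormedSpace ℝ E]
  [NormedAddCommGroup F] [NormedSpace ℝ F] [Fintype ι] {g : E → F → ℝ} {c : ι → E → F → ℝ}
  {μ : ℝ} {y : E → F} {w : E → ι → ℝ}

section Regularity

theorem contDiff_fderiv_obj (h : IsKKTFamily g c μ y w) :
    ContDiff ℝ 1 fun z : E × F => fderiv ℝ (g z.1) z.2 :=
  ContDiff.fderiv (f := fun (z : E × F) => g z.1) (m := 2)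
    (h.contDiff_obj.comp (contDiff_fst.fst.prodMk contDiff_snd)) contDiff_snd (by norm_num)

theorem contDiff_fderiv_con (h : IsKKTFamily g c μ y w) (k : ι) :
    ContDiff ℝ 1 fun z : E × F => fderiv ℝ (c k z.1) z.2 :=
  ContDiff.fderiv (f := fun (z : E × F) => c k z.1) (m := 2)
    ((h.contDiff_con k).comp (contDiff_fst.fst.prodMk contDiff_snd)) contDiff_snd (by norm_num)

theorem differentiable_con (h : IsKKTFamily g c μ y w) (k : ι) (x : E) :
    Differentiable ℝ (c k x) :=
  ((h.contDiff_con k).comp (contDiff_const.prodMk contDiff_id)).differentiable (by norm_num)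

theorem contDiff_data (h : IsKKTFamily g c μ y w) :
    ContDiff ℝ 1 fun z : E × F => (fderiv ℝ (g z.1) z.2,
      (fun k => fderiv ℝ (c k z.1) z.2), fun k => c k z.1 z.2) :=
  h.contDiff_fderiv_obj.prodMk ((contDiff_pi.2 h.contDiff_fderiv_con).prodMk
    (contDiff_pi.2 fun k => (h.contDiff_con k).of_le (by norm_num)))

end Regularity

/-- The Lagrangian at `x` is minimized at `y x`, with quadratic growth. -/
theorem lagrangian_lower (h : IsKKTFamily g c μ y w) (x : E) (z : F) :
    g x (y x) + μ / 2 * ‖z - y x‖ ^ 2 ≤ g x z + ∑ k, w x k * c k x z := by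
  have h1 := h.obj_lower x (y x) z
  have h2 := Finset.sum_le_sum fun k (_ : k ∈ Finset.univ) => h.con_lower x x k (y x) z
  have h3 := DFunLike.congr_fun (h.stationary x) (z - y x)
  simp only [mul_sub, h.compl, sub_zero] at h2
  simp only [add_apply, sum_apply, smul_apply,
    smul_eq_mul, zero_apply] at h3
  linarith

theorem fderiv_obj_mono (h : IsKKTFamily g c μ y w) (x : E) (u v : F) :
    μ * ‖v - u‖ ^ 2 ≤ fderiv ℝ (g x) v (v - u) - fderiv ℝ (g x) u (v - u) := by
  have h1 := h.obj_lower x u v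
  have h2 := h.obj_lower x v u
  rw [← neg_sub v u, map_neg, norm_neg] at h2
  linarith

/-- Basic stability inequality between the KKT points at two parameters. -/
theorem mul_sq_norm_sub_le (h : IsKKTFamily g c μ y w) (x₁ x₂ : E) :
    μ * ‖y x₂ - y x₁‖ ^ 2 ≤
      ‖fderiv ℝ (g x₁) (y x₂) + ∑ k, w x₂ k • fderiv ℝ (c k x₁) (y x₂)‖ * ‖y x₂ - y x₁‖
        + ∑ k, |w x₂ k - w x₁ k| * |c k x₁ (y x₂) - c k x₂ (y x₂)| := by
  set v := y x₂ - y x₁ with hv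
  have h1 := h.fderiv_obj_mono x₁ (y x₁) (y x₂)
  have h2 := DFunLike.congr_fun (h.stationary x₁) v
  have h3 : (fderiv ℝ (g x₁) (y x₂) + ∑ k, w x₂ k • fderiv ℝ (c k x₁) (y x₂)) v ≤
      ‖fderiv ℝ (g x₁) (y x₂) + ∑ k, w x₂ k • fderiv ℝ (c k x₁) (y x₂)‖ * ‖v‖ :=
    (le_abs_self _).trans
      ((fderiv ℝ (g x₁) (y x₂) + ∑ k, w x₂ k • fderiv ℝ (c k x₁) (y x₂)).le_opNorm v)
  have h4 : ∀ k, -(|w x₂ k - w x₁ k| * |c k x₁ (y x₂) - c k x₂ (y x₂)|) ≤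
      w x₂ k * fderiv ℝ (c k x₁) (y x₂) v - w x₁ k * fderiv ℝ (c k x₁) (y x₁) v := by
    intro k
    have a1 := h.con_lower x₁ x₂ k (y x₂) (y x₁)
    have a2 := h.con_lower x₁ x₁ k (y x₁) (y x₂)
    rw [← neg_sub (y x₂) (y x₁), map_neg] at a1
    have a3 := h.cross x₁ x₂ k
    have a4 := h.cross x₂ x₁ k
    have a5 := h.compl x₁ k
    have a6 := h.compl x₂ k
    have a7 := neg_abs_le ((w x₂ k - w x₁ k) * (c k x₁ (y x₂) - c k x₂ (y x₂)))
    rw [abs_mul] at a7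
    rw [← hv] at a1 a2
    linarith
  have h5 := Finset.sum_le_sum fun k (_ : k ∈ Finset.univ) => h4 k
  simp only [add_apply, sum_apply, smul_apply,
    smul_eq_mul, zero_apply] at h2 h3
  rw [Finset.sum_neg_distrib, Finset.sum_sub_distrib] at h5
  linarith

/-- Near a parameter at which the constraint gradients are linearly independent, multipliers with a
prescribed sign pattern admit a common strictly feasible point. -/
theorem exists_strictly_feasible (h : IsKKTFamily g c μ y w) (x₀ : E) (s : ι → SignType) :
    ∃ z : F, ∃ δ > 0, ∀ᶠ x in 𝓝 x₀, (∀ k, SignType.sign (w x k) = s k) →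
      ∀ k, w x k * c k x z ≤ -δ * |w x k| := by
  by_cases hs : ∃ x', ∀ k, SignType.sign (w x' k) = s k
  swap
  · exact ⟨0, 1, one_pos, Eventually.of_forall fun x hx => absurd ⟨x, hx⟩ hs⟩
  obtain ⟨x', hx'⟩ := hs
  obtain ⟨d, hd⟩ := (h.licq x₀).exists_apply_eq fun k => -(s k : ℝ)
  have hray : ∀ᶠ t in 𝓝[>] (0 : ℝ), ∀ k, s k ≠ 0 → (s k : ℝ) * c k x₀ (y x₀ + t • d) < 0 := by
    refine eventually_all.2 fun k => ?_
    by_cases hsk : s k = 0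
    · exact Eventually.of_forall fun _ hne => absurd hsk hne
    have hsq : 0 < (s k : ℝ) * s k := by
      rcases h3 : s k <;> simp_all
    have hline : HasDerivAt (fun t : ℝ => (s k : ℝ) * c k x₀ (y x₀ + t • d))
        (s k * fderiv ℝ (c k x₀) (y x₀) d) 0 := by
      have h0 : HasDerivAt (fun t : ℝ => y x₀ + t • d) d 0 := by
        simpa using ((hasDerivAt_id (0 : ℝ)).smul_const d).const_add (y x₀)
      have h1 : HasFDerivAt (c k x₀) (fderiv ℝ (c k x₀) (y x₀)) (y x₀ + (0 : ℝ) • d) := by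
        simpa using (h.differentiable_con k x₀ (y x₀)).hasFDerivAt
      exact (h1.comp_hasDerivAt 0 h0).const_mul _
    by_cases hact : c k x₀ (y x₀) = 0
    · have hneg : (s k : ℝ) * fderiv ℝ (c k x₀) (y x₀) d < 0 := by
        rw [hd k hact]
        linarith
      have hev := (hasDerivAt_iff_tendsto_slope.1 hline).eventually_lt_const hneg
      filter_upwards [hev.filter_mono (nhdsWithin_mono 0 fun t (ht : 0 < t) => ht.ne'),
        self_mem_nhdsWithin] with t ht htpos _
      have htpos' : 0 < t := htpos
      rw [slope_def_field] at ht
      simp only [zero_smul, add_zero, hact, mul_zero, sub_zero] at ht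
      exact (div_neg_iff.1 ht).elim (fun H => absurd htpos' H.2.not_gt) fun H => H.1
    · have hneg : (s k : ℝ) * c k x₀ (y x₀) < 0 := by
        refine lt_of_le_of_ne ?_ (mul_ne_zero (fun h0 => by simp [h0] at hsq) hact)
        have hc := h.cross x' x₀ k
        rcases lt_trichotomy (w x' k) 0 with hw | hw | hw
        · rw [← hx' k, sign_neg hw]
          have : 0 ≤ c k x₀ (y x₀) := by nlinarith
          simpa using this
        · rw [← hx' k, hw]
          simp
        · rw [← hx' k, sign_pos hw]
          have : c k x₀ (y x₀) ≤ 0 := by nlinarith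
          simpa using this
      have hev := hline.continuousAt.eventually_lt continuousAt_const (by simpa using hneg)
      exact (hev.filter_mono nhdsWithin_le_nhds).mono fun t ht _ => ht
  obtain ⟨t, ht⟩ := hray.exists
  have hmargin : ∀ᶠ δ in 𝓝[>] (0 : ℝ), ∀ k, s k ≠ 0 →
      (s k : ℝ) * c k x₀ (y x₀ + t • d) < -δ := by
    refine eventually_all.2 fun k => ?_
    by_cases hsk : s k = 0
    · exact Eventually.of_forall fun _ hne => absurd hsk hne
    have hev : ∀ᶠ δ in 𝓝 (0 : ℝ), (s k : ℝ) * c k x₀ (y x₀ + t • d) < -δ :=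
      continuousAt_const.eventually_lt continuous_neg.continuousAt (by simpa using ht k hsk)
    exact (hev.filter_mono nhdsWithin_le_nhds).mono fun δ hδ _ => hδ
  obtain ⟨δ, hδ, hδpos⟩ := (hmargin.and self_mem_nhdsWithin).exists
  refine ⟨y x₀ + t • d, δ, hδpos, ?_⟩
  have hnear : ∀ᶠ x in 𝓝 x₀, ∀ k, s k ≠ 0 → (s k : ℝ) * c k x (y x₀ + t • d) < -δ := by
    refine eventually_all.2 fun k => ?_
    by_cases hsk : s k = 0
    · exact Eventually.of_forall fun _ hne => absurd hsk hne
    have hcont : Continuous fun x => (s k : ℝ) * c k x (y x₀ + t • d) :=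
      continuous_const.mul
        ((h.contDiff_con k).continuous.comp (continuous_id.prodMk continuous_const))
    exact (hcont.continuousAt.eventually_lt continuousAt_const (hδ k hsk)).mono fun _ hx _ => hx
  refine hnear.mono fun x hx hsx k => ?_
  by_cases hsk : s k = 0
  · have : w x k = 0 := sign_eq_zero_iff.1 ((hsx k).trans hsk)
    simp [this]
  · have h1 : w x k * c k x (y x₀ + t • d) = |w x k| * ((s k : ℝ) * c k x (y x₀ + t • d)) := by
      rw [← hsx k, ← mul_assoc, abs_mul_sign]
    rw [h1, mul_comm (-δ)]
    exact mul_le_mul_of_nonneg_left (hx k hsk).le (abs_nonneg _)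

theorem eventually_bounded (h : IsKKTFamily g c μ y w) (x₀ : E) :
    ∃ B, ∀ᶠ x in 𝓝 x₀, ‖y x‖ ≤ B ∧ ∑ k, |w x k| ≤ B := by
  classical
  have hpat : ∀ s : ι → SignType, ∃ B, ∀ᶠ x in 𝓝 x₀, (∀ k, SignType.sign (w x k) = s k) →
      ‖y x‖ ≤ B ∧ ∑ k, |w x k| ≤ B := by
    intro s
    obtain ⟨z, δ, hδ, hz⟩ := h.exists_strictly_feasible x₀ s
    have hcont : Continuous fun x => ‖fderiv ℝ (g x) z‖ :=
      (h.contDiff_fderiv_obj.continuous.comp (continuous_id.prodMk continuous_const)).norm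
    set M := ‖fderiv ℝ (g x₀) z‖ + 1
    have hM : ∀ᶠ x in 𝓝 x₀, ‖fderiv ℝ (g x) z‖ < M :=
      hcont.continuousAt.eventually_lt continuousAt_const (by simp [M])
    have hμ := h.pos
    refine ⟨max (M / μ + ‖z‖) (M * (M / μ) / δ), ?_⟩
    filter_upwards [hz, hM] with x hx hMx hsx
    have h1 := h.lagrangian_lower x z
    have h2 := h.obj_lower x z (y x)
    have h3 := Finset.sum_le_sum fun k (_ : k ∈ Finset.univ) => hx hsx k
    rw [← Finset.mul_sum] at h3
    have h4 : -(M * ‖z - y x‖) ≤ fderiv ℝ (g x) z (y x - z) := by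
      refine (neg_le_neg ?_).trans (neg_abs_le _)
      rw [norm_sub_rev]
      exact ((fderiv ℝ (g x) z).le_opNorm _).trans (by gcongr)
    rw [norm_sub_rev] at h2
    set r := ‖z - y x‖ with hr
    have hr0 : 0 ≤ r := norm_nonneg _
    have hw0 : 0 ≤ ∑ k, |w x k| := by positivity
    have h5 : μ * r ^ 2 + δ * ∑ k, |w x k| ≤ M * r := by linarith
    have hrM : r ≤ M / μ := by
      rw [le_div_iff₀ hμ]
      by_contra! hcon
      have : 0 < r := lt_of_le_of_ne hr0 fun h0 => by
        rw [← h0, zero_mul] at hcon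
        linarith [norm_nonneg (fderiv ℝ (g x₀) z)]
      nlinarith [mul_nonneg hδ.le hw0]
    refine ⟨le_max_of_le_left ?_, le_max_of_le_right ?_⟩
    · have : ‖y x‖ ≤ ‖z‖ + ‖z - y x‖ := by
        simpa using norm_sub_le z (z - y x)
      linarith
    · rw [le_div_iff₀ hδ]
      have : M * r ≤ M * (M / μ) := by gcongr
      nlinarith [mul_nonneg hμ.le (sq_nonneg r)]
  choose B hB using hpat
  refine ⟨∑ s, |B s|, (eventually_all.2 hB).mono fun x hx => ?_⟩
  have hle : B (fun k => SignType.sign (w x k)) ≤ ∑ s, |B s| :=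
    (le_abs_self _).trans (Finset.single_le_sum (f := fun s => |B s|)
      (fun s _ => abs_nonneg (B s)) (Finset.mem_univ _))
  have := hx (fun k => SignType.sign (w x k)) fun _ => rfl
  exact ⟨this.1.trans hle, this.2.trans hle⟩

theorem continuousAt (h : IsKKTFamily g c μ y w) (x₀ : E) : ContinuousAt y x₀ := by
  obtain ⟨B, hB⟩ := h.eventually_bounded x₀
  have hB₀ := hB.self_of_nhds
  have hΨ : Continuous fun x => (2 * B) *
      ‖fderiv ℝ (g x) (y x₀) + ∑ k, w x₀ k • fderiv ℝ (c k x) (y x₀)‖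
        + ∑ k, (2 * B) * |c k x (y x₀) - c k x₀ (y x₀)| := by
    have e : Continuous fun x : E => (x, y x₀) := by fun_prop
    have e1 := h.contDiff_fderiv_obj.continuous.comp e
    have e2 := fun k => (h.contDiff_fderiv_con k).continuous.comp e
    have e3 := fun k => (h.contDiff_con k).continuous.comp e
    simp only [Function.comp_def, Function.uncurry] at e1 e2 e3
    fun_prop
  have hΨ0 := hΨ.tendsto x₀
  simp only [h.stationary, norm_zero, mul_zero, sub_self, abs_zero, Finset.sum_const_zero,
    add_zero] at hΨ0
  have hsq : Tendsto (fun x => μ * ‖y x₀ - y x‖ ^ 2) (𝓝 x₀) (𝓝 0) := by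
    refine squeeze_zero' (Eventually.of_forall fun x => mul_nonneg h.pos.le (sq_nonneg _))
      (hB.mono fun x hx => ?_) hΨ0
    refine (h.mul_sq_norm_sub_le x x₀).trans (add_le_add ?_ (Finset.sum_le_sum fun k _ => ?_))
    · rw [mul_comm]
      gcongr
      linarith [norm_sub_le (y x₀) (y x)]
    · gcongr
      have a1 := Finset.single_le_sum (f := fun k => |w x k|)
        (fun k _ => abs_nonneg (w x k)) (Finset.mem_univ k)
      have a2 := Finset.single_le_sum (f := fun k => |w x₀ k|)
        (fun k _ => abs_nonneg (w x₀ k)) (Finset.mem_univ k)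
      linarith [abs_sub (w x₀ k) (w x k)]
  have hlim := (hsq.const_mul μ⁻¹).sqrt
  simp only [inv_mul_cancel_left₀ h.pos.ne', mul_zero, Real.sqrt_zero,
    Real.sqrt_sq (norm_nonneg _)] at hlim
  rw [ContinuousAt, tendsto_iff_norm_sub_tendsto_zero]
  simpa only [norm_sub_rev] using hlim

theorem eventually_inactive (h : IsKKTFamily g c μ y w) (x₀ : E) :
    ∀ᶠ x in 𝓝 x₀, ∀ k, c k x₀ (y x₀) ≠ 0 → c k x (y x) ≠ 0 := by
  refine eventually_all.2 fun k => ?_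
  by_cases hk : c k x₀ (y x₀) = 0
  · exact Eventually.of_forall fun _ hne => absurd hk hne
  have hcont : ContinuousAt (fun x => c k x (y x)) x₀ :=
    ContinuousAt.comp (g := Function.uncurry (c k)) (f := fun x => (x, y x))
      (h.contDiff_con k).continuous.continuousAt (continuousAt_id.prodMk (h.continuousAt x₀))
  exact (hcont.eventually_ne hk).mono fun _ hx _ => hx

theorem eventually_mult_eq_zero (h : IsKKTFamily g c μ y w) (x₀ : E) :
    ∀ᶠ x in 𝓝 x₀, ∀ k, c k x₀ (y x₀) ≠ 0 → w x k = 0 :=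
  (h.eventually_inactive x₀).mono fun x hx k hk =>
    (mul_eq_zero.1 (h.compl x k)).resolve_right (hx k hk)

theorem eventually_sum_abs_le (h : IsKKTFamily g c μ y w) (x₀ : E) :
    ∃ M : ℝ, 0 ≤ M ∧ ∀ᶠ x in 𝓝 x₀, ∀ a : ι → ℝ, (∀ k, c k x₀ (y x₀) ≠ 0 → a k = 0) →
      ∑ k, |a k| ≤ M * ‖∑ k, a k • fderiv ℝ (c k x) (y x)‖ := by
  obtain ⟨M, hM, hev⟩ := (h.licq x₀).eventually_sum_abs_le
  refine ⟨M, hM, ?_⟩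
  have hcont : ContinuousAt (fun x k => fderiv ℝ (c k x) (y x)) x₀ :=
    continuousAt_pi.2 fun k =>
      ContinuousAt.comp (g := fun z : E × F => fderiv ℝ (c k z.1) z.2) (f := fun x => (x, y x))
        (h.contDiff_fderiv_con k).continuous.continuousAt
        (continuousAt_id.prodMk (h.continuousAt x₀))
  exact (hcont.eventually hev).mono fun x hx a ha => hx a ha

theorem exists_lipschitz_near (h : IsKKTFamily g c μ y w) (x₀ : E) :
    ∃ L : ℝ, 0 ≤ L ∧ ∃ U ∈ 𝓝 x₀, ∀ x₁ ∈ U, ∀ x₂ ∈ U,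
      ‖y x₁ - y x₂‖ ≤ L * ‖x₁ - x₂‖ ∧ ∑ k, |w x₁ k - w x₂ k| ≤ L * ‖x₁ - x₂‖ := by
  obtain ⟨K, t, ht, hK⟩ :=
    (h.contDiff_data.contDiffAt (x := (x₀, y x₀))).exists_lipschitzOnWith
  obtain ⟨u, hu, v, hv, huv⟩ := mem_nhds_prod_iff.1 ht
  obtain ⟨W, hW⟩ := h.eventually_bounded x₀
  obtain ⟨M, hM, hMx⟩ := h.eventually_sum_abs_le x₀
  have hμ := h.pos
  have hW0 : 0 ≤ W := (norm_nonneg _).trans hW.self_of_nhds.1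
  have hdata : ∀ x₁ ∈ u, ∀ x₂ ∈ u, ∀ y₁ ∈ v, ∀ y₂ ∈ v,
      ‖fderiv ℝ (g x₁) y₁ - fderiv ℝ (g x₂) y₂‖ ≤ K * (‖x₁ - x₂‖ + ‖y₁ - y₂‖) ∧
      (∀ k, ‖fderiv ℝ (c k x₁) y₁ - fderiv ℝ (c k x₂) y₂‖ ≤ K * (‖x₁ - x₂‖ + ‖y₁ - y₂‖)) ∧
      ∀ k, |c k x₁ y₁ - c k x₂ y₂| ≤ K * (‖x₁ - x₂‖ + ‖y₁ - y₂‖) := by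
    intro x₁ hx₁ x₂ hx₂ y₁ hy₁ y₂ hy₂
    have h1 := hK.norm_sub_le (huv (Set.mk_mem_prod hx₁ hy₁)) (huv (Set.mk_mem_prod hx₂ hy₂))
    have h2 : ‖((x₁, y₁) : E × F) - (x₂, y₂)‖ ≤ ‖x₁ - x₂‖ + ‖y₁ - y₂‖ :=
      max_le (le_add_of_nonneg_right (norm_nonneg _)) (le_add_of_nonneg_left (norm_nonneg _))
    replace h1 := h1.trans (mul_le_mul_of_nonneg_left h2 K.coe_nonneg)
    refine ⟨(norm_fst_le _).trans h1, fun k => ?_, fun k => ?_⟩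
    · exact (norm_le_pi_norm
        (fun k => fderiv ℝ (c k x₁) y₁ - fderiv ℝ (c k x₂) y₂) k).trans
        (((norm_fst_le _).trans (norm_snd_le _)).trans h1)
    · exact (norm_le_pi_norm (fun k => c k x₁ y₁ - c k x₂ y₂) k).trans
        (((norm_snd_le _).trans (norm_snd_le _)).trans h1)
  set P : ℝ := K * (1 + W) with hP
  have hP0 : 0 ≤ P := by positivity
  set Q : ℝ := K * (M * P) with hQ
  have hQ0 : 0 ≤ Q := by positivity
  set N : ℝ := (P + 2 * Q) / μ + 1 with hN
  have hN0 : 0 ≤ N := by positivity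
  have hU : ∀ᶠ x in 𝓝 x₀, x ∈ u ∧ y x ∈ v ∧ (∑ k, |w x k| ≤ W) ∧
      (∀ a : ι → ℝ, (∀ k, c k x₀ (y x₀) ≠ 0 → a k = 0) →
        ∑ k, |a k| ≤ M * ‖∑ k, a k • fderiv ℝ (c k x) (y x)‖) ∧
      ∀ k, c k x₀ (y x₀) ≠ 0 → w x k = 0 := by
    filter_upwards [hu, (h.continuousAt x₀) hv, hW, hMx, h.eventually_mult_eq_zero x₀]
      with x a1 a2 a3 a4 a5 using ⟨a1, a2, a3.2, a4, a5⟩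
  refine ⟨N + M * (P * (1 + N)), by positivity, _, hU, ?_⟩
  rintro x₁ ⟨hx₁, hy₁, hw₁, hM₁, hz₁⟩ x₂ ⟨hx₂, hy₂, hw₂, hM₂, hz₂⟩
  set e := ‖x₁ - x₂‖ with he
  have he0 : 0 ≤ e := norm_nonneg _
  have hres : ∀ y' ∈ v, ‖fderiv ℝ (g x₁) y' + ∑ k, w x₂ k • fderiv ℝ (c k x₁) y'‖ ≤
      P * (e + ‖y' - y x₂‖) := by
    intro y' hy'
    obtain ⟨d1, d2, -⟩ := hdata x₁ hx₁ x₂ hx₂ y' hy' (y x₂) hy₂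
    have heq : fderiv ℝ (g x₁) y' + ∑ k, w x₂ k • fderiv ℝ (c k x₁) y' =
        (fderiv ℝ (g x₁) y' - fderiv ℝ (g x₂) (y x₂)) +
          ∑ k, w x₂ k • (fderiv ℝ (c k x₁) y' - fderiv ℝ (c k x₂) (y x₂)) := by
      simp only [smul_sub, Finset.sum_sub_distrib]
      rw [eq_comm, ← sub_eq_zero]
      have := h.stationary x₂
      rw [← neg_eq_zero] at this
      rw [← this]
      abel
    have hsum : ‖∑ k, w x₂ k • (fderiv ℝ (c k x₁) y' - fderiv ℝ (c k x₂) (y x₂))‖ ≤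
        W * (K * (e + ‖y' - y x₂‖)) := by
      calc _ ≤ ∑ k, |w x₂ k| * (K * (e + ‖y' - y x₂‖)) := by
            refine (norm_sum_le _ _).trans (Finset.sum_le_sum fun k _ => ?_)
            rw [norm_smul, Real.norm_eq_abs]
            exact mul_le_mul_of_nonneg_left (d2 k) (abs_nonneg _)
        _ ≤ _ := by
            rw [← Finset.sum_mul]
            gcongr
    rw [heq]
    refine (norm_add_le _ _).trans ((add_le_add d1 hsum).trans_eq ?_)
    rw [hP]
    ring
  set r := ‖y x₁ - y x₂‖ with hr
  have hr0 : 0 ≤ r := norm_nonneg _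
  set A := ∑ k, |w x₁ k - w x₂ k| with hA
  have hA_le : A ≤ M * (P * (e + r)) := by
    refine (hM₁ (fun k => w x₁ k - w x₂ k) fun k hk => by
      simp [hz₁ k hk, hz₂ k hk]).trans (mul_le_mul_of_nonneg_left ?_ hM)
    have heq : ∑ k, (w x₁ k - w x₂ k) • fderiv ℝ (c k x₁) (y x₁) =
        -(fderiv ℝ (g x₁) (y x₁) + ∑ k, w x₂ k • fderiv ℝ (c k x₁) (y x₁)) := by
      simp only [sub_smul, Finset.sum_sub_distrib]
      rw [← sub_eq_zero, ← h.stationary x₁]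
      abel
    rw [heq, norm_neg]
    exact hres _ hy₁
  have hr_le : r ≤ N * e := by
    have h1 := h.mul_sq_norm_sub_le x₁ x₂
    have h2 := hres _ hy₂
    have h3 : ∑ k, |w x₂ k - w x₁ k| * |c k x₁ (y x₂) - c k x₂ (y x₂)| ≤ A * (K * e) := by
      rw [hA, Finset.sum_mul]
      refine Finset.sum_le_sum fun k _ => ?_
      rw [abs_sub_comm]
      refine mul_le_mul_of_nonneg_left ?_ (abs_nonneg _)
      simpa using (hdata x₁ hx₁ x₂ hx₂ (y x₂) hy₂ (y x₂) hy₂).2.2 k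
    rw [sub_self, norm_zero, add_zero] at h2
    rw [norm_sub_rev (y x₂)] at h1
    have h4 : A * (K * e) ≤ Q * (e + r) * e := by
      calc A * (K * e) ≤ M * (P * (e + r)) * (K * e) := by gcongr
        _ = Q * (e + r) * e := by rw [hQ]; ring
    have h5 : μ * r ^ 2 ≤ P * e * r + Q * (e + r) * e :=
      h1.trans (add_le_add (mul_le_mul_of_nonneg_right h2 hr0) (h3.trans h4))
    rcases le_or_gt r e with hle | hlt
    · have : 1 * e ≤ N * e := by
        gcongr
        exact le_add_of_nonneg_left (by positivity)
      linarith
    · have hrpos : 0 < r := he0.trans_lt hlt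
      have h6 : μ * r ^ 2 ≤ ((P + 2 * Q) * e) * r := by
        nlinarith [mul_nonneg (mul_nonneg hQ0 he0) (sub_nonneg.2 hlt.le)]
      have h7 : μ * r ≤ (P + 2 * Q) * e := by
        refine le_of_mul_le_mul_right ?_ hrpos
        linarith
      have h8 : r ≤ (P + 2 * Q) / μ * e := by
        rw [div_mul_eq_mul_div, le_div_iff₀ hμ]
        linarith
      rw [hN]
      linarith
  have hfin : M * (P * (e + r)) ≤ M * (P * (1 + N)) * e := by
    calc M * (P * (e + r)) ≤ M * (P * (e + N * e)) := by gcongr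
      _ = _ := by ring
  constructor
  · have : 0 ≤ M * (P * (1 + N)) * e := by positivity
    linarith
  · have : 0 ≤ N * e := by positivity
    linarith

theorem locallyLipschitz (h : IsKKTFamily g c μ y w) : LocallyLipschitz y := by
  intro x₀
  obtain ⟨L, hL, U, hU, hUL⟩ := h.exists_lipschitz_near x₀
  refine ⟨L.toNNReal, U, hU, LipschitzOnWith.of_dist_le_mul fun x₁ hx₁ x₂ hx₂ => ?_⟩
  simpa [dist_eq_norm, hL] using (hUL x₁ hx₁ x₂ hx₂).1

theorem locallyLipschitz_mult (h : IsKKTFamily g c μ y w) (k : ι) :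
    LocallyLipschitz fun x => w x k := by
  intro x₀
  obtain ⟨L, hL, U, hU, hUL⟩ := h.exists_lipschitz_near x₀
  refine ⟨L.toNNReal, U, hU, LipschitzOnWith.of_dist_le_mul fun x₁ hx₁ x₂ hx₂ => ?_⟩
  rw [Real.dist_eq, dist_eq_norm, Real.coe_toNNReal _ hL]
  exact (Finset.single_le_sum (f := fun k => |w x₁ k - w x₂ k|)
    (fun k _ => abs_nonneg (w x₁ k - w x₂ k)) (Finset.mem_univ k)).trans (hUL x₁ hx₁ x₂ hx₂).2

theorem _root_.LocallyLipschitz.comp_graph {φ : E → F → ℝ} {y : E → F}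
    (hφ : ContDiff ℝ 1 (Function.uncurry φ)) (hy : LocallyLipschitz y) :
    LocallyLipschitz fun x => φ x (y x) :=
  hφ.locallyLipschitz.comp (LocallyLipschitz.id.prodMk hy)

/-- The derivative of a strongly monotone operator is coercive. -/
theorem _root_.HasFDerivAt.mul_sq_norm_le_of_mono {S : F → F →L[ℝ] ℝ} {D : F →L[ℝ] F →L[ℝ] ℝ}
    {m : ℝ} {u : F} (hS : HasFDerivAt S D u)
    (hmono : ∀ u', m * ‖u' - u‖ ^ 2 ≤ S u' (u' - u) - S u (u' - u)) (v : F) :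
    m * ‖v‖ ^ 2 ≤ D v v := by
  have hline : HasDerivAt (fun t : ℝ => S (u + t • v) v) (D v v) 0 := by
    have h0 : HasDerivAt (fun t : ℝ => u + t • v) v 0 := by
      simpa using ((hasDerivAt_id (0 : ℝ)).smul_const v).const_add u
    have h1 : HasFDerivAt S D (u + (0 : ℝ) • v) := by simpa using hS
    exact (ContinuousLinearMap.apply ℝ ℝ v).hasFDerivAt.comp_hasDerivAt 0
      (h1.comp_hasDerivAt 0 h0)
  have hlim := (hasDerivAt_iff_tendsto_slope.1 hline).mono_left
    (nhdsWithin_mono 0 fun t (ht : t ∈ Set.Ioi (0 : ℝ)) => ne_of_gt ht)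
  refine ge_of_tendsto hlim ?_
  filter_upwards [self_mem_nhdsWithin] with t ht
  have ht0 : 0 < t := ht
  have := hmono (u + t • v)
  rw [add_sub_cancel_left, norm_smul, Real.norm_of_nonneg ht0.le, map_smul, map_smul,
    smul_eq_mul, smul_eq_mul] at this
  rw [slope_def_field, sub_zero, zero_smul, add_zero, le_div_iff₀ ht0]
  refine le_of_mul_le_mul_left ?_ ht0
  linarith

/-- The KKT system in which the constraints in `A` hold with equality and the multipliers of the
remaining ones vanish. -/
noncomputable def kktMap (g : E → F → ℝ) (c : ι → E → F → ℝ) (A : Set ι) [DecidablePred (· ∈ A)]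
    (z : E × F × (ι → ℝ)) : (F →L[ℝ] ℝ) × (ι → ℝ) :=
  (fderiv ℝ (g z.1) z.2.1 + ∑ k, z.2.2 k • fderiv ℝ (c k z.1) z.2.1,
    fun k => if k ∈ A then c k z.1 z.2.1 else z.2.2 k)

theorem contDiff_kktMap (h : IsKKTFamily g c μ y w) (A : Set ι) [DecidablePred (· ∈ A)] :
    ContDiff ℝ 1 (kktMap g c A) := by
  have e : ContDiff ℝ 1 fun z : E × F × (ι → ℝ) => (z.1, z.2.1) := by fun_prop
  have e1 : ContDiff ℝ 1 fun z : E × F × (ι → ℝ) => fderiv ℝ (g z.1) z.2.1 :=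
    h.contDiff_fderiv_obj.comp e
  have e2 : ∀ k, ContDiff ℝ 1 fun z : E × F × (ι → ℝ) => fderiv ℝ (c k z.1) z.2.1 :=
    fun k => (h.contDiff_fderiv_con k).comp e
  have e3 : ∀ k, ContDiff ℝ 1 fun z : E × F × (ι → ℝ) => c k z.1 z.2.1 :=
    fun k => ((h.contDiff_con k).of_le (by norm_num)).comp e
  refine ContDiff.prodMk (e1.add (ContDiff.sum fun k _ => ContDiff.fun_smul (f := fun z => z.2.2 k) (by fun_prop) (e2 k)))
    (contDiff_pi.2 fun k => ?_)
  by_cases hk : k ∈ A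
  · simpa only [hk, if_true] using e3 k
  · simp only [hk, if_false]
    fun_prop

theorem kktMap_injective (h : IsKKTFamily g c μ y w) (x₀ : E) (A : Set ι)
    [DecidablePred (· ∈ A)] (hA : A = {k | c k x₀ (y x₀) = 0}) :
    Function.Injective (fderiv ℝ (kktMap g c A) (x₀, y x₀, w x₀) ∘L
      ContinuousLinearMap.inr ℝ E (F × (ι → ℝ))) := by
  rw [injective_iff_map_eq_zero]
  rintro ⟨v, a⟩ hva
  have hpath : HasDerivAt (fun t : ℝ => ((x₀, y x₀ + t • v, w x₀ + t • a) : E × F × (ι → ℝ)))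
      (0, v, a) 0 := by
    have h0 : HasDerivAt (fun t : ℝ => y x₀ + t • v) v 0 := by
      simpa using ((hasDerivAt_id (0 : ℝ)).smul_const v).const_add (y x₀)
    have h1 : HasDerivAt (fun t : ℝ => w x₀ + t • a) a 0 := by
      simpa using ((hasDerivAt_id (0 : ℝ)).smul_const a).const_add (w x₀)
    exact (hasDerivAt_const (0 : ℝ) x₀).prodMk (h0.prodMk h1)
  have hcomp : HasDerivAt
      (fun t : ℝ => kktMap g c A (x₀, y x₀ + t • v, w x₀ + t • a)) 0 0 := by
    have hd : HasFDerivAt (kktMap g c A) (fderiv ℝ (kktMap g c A) (x₀, y x₀, w x₀))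
        (x₀, y x₀ + (0 : ℝ) • v, w x₀ + (0 : ℝ) • a) := by
      simpa using ((h.contDiff_kktMap A).differentiable one_ne_zero
        (x₀, y x₀, w x₀)).hasFDerivAt
    have := hd.comp_hasDerivAt (0 : ℝ) hpath
    rwa [show fderiv ℝ (kktMap g c A) (x₀, y x₀, w x₀) (0, v, a) = 0 from hva] at this
  have hy : HasDerivAt (fun t : ℝ => y x₀ + t • v) v 0 := hpath.snd.fst
  have hcon : ∀ k, HasDerivAt (fun t : ℝ => if k ∈ A then c k x₀ (y x₀ + t • v)
      else (w x₀ + t • a) k) 0 0 := fun k => hasDerivAt_pi.1 hcomp.snd k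
  have hact : ∀ k ∈ A, fderiv ℝ (c k x₀) (y x₀) v = 0 := by
    intro k hk
    have h1 : HasFDerivAt (c k x₀) (fderiv ℝ (c k x₀) (y x₀)) (y x₀ + (0 : ℝ) • v) := by
      simpa using (h.differentiable_con k x₀ (y x₀)).hasFDerivAt
    have h2 := hcon k
    simp only [hk, if_true] at h2
    exact (h1.comp_hasDerivAt 0 hy).unique h2
  have hinact : ∀ k ∉ A, a k = 0 := by
    intro k hk
    have h2 := hcon k
    simp only [hk, if_false] at h2
    exact (hasDerivAt_pi.1 hpath.snd.snd k).unique h2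
  have e : ContDiff ℝ 1 fun u : F => (x₀, u) := by fun_prop
  set S : F → F →L[ℝ] ℝ := fun u => fderiv ℝ (g x₀) u + ∑ k, w x₀ k • fderiv ℝ (c k x₀) u with hS
  have hCd : ∀ k, ContDiff ℝ 1 fun u => fderiv ℝ (c k x₀) u :=
    fun k => (h.contDiff_fderiv_con k).comp e
  have hSd : ContDiff ℝ 1 S :=
    (h.contDiff_fderiv_obj.comp e).add (ContDiff.sum fun k _ => contDiff_const.fun_smul (hCd k))
  have hSD := (hSd.differentiable one_ne_zero (y x₀)).hasFDerivAt
  have hcoer := hSD.mul_sq_norm_le_of_mono (m := μ) (fun u => by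
    have h1 := h.fderiv_obj_mono x₀ (y x₀) u
    have h2 : 0 ≤ ∑ k, (w x₀ k * fderiv ℝ (c k x₀) u (u - y x₀) -
        w x₀ k * fderiv ℝ (c k x₀) (y x₀) (u - y x₀)) := Finset.sum_nonneg fun k _ => by
      have a1 := h.con_lower x₀ x₀ k (y x₀) u
      have a2 := h.con_lower x₀ x₀ k u (y x₀)
      rw [← neg_sub u, map_neg] at a2
      linarith
    rw [Finset.sum_sub_distrib] at h2
    simp only [hS, add_apply, sum_apply, smul_apply, smul_eq_mul]
    linarith) v
  have hsum : HasDerivAt (fun t : ℝ => S (y x₀ + t • v) +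
      ∑ k, (t * a k) • fderiv ℝ (c k x₀) (y x₀ + t • v))
      (fderiv ℝ S (y x₀) v + ∑ k, a k • fderiv ℝ (c k x₀) (y x₀)) 0 := by
    have h1 : HasFDerivAt S (fderiv ℝ S (y x₀)) (y x₀ + (0 : ℝ) • v) := by simpa using hSD
    refine (h1.comp_hasDerivAt 0 hy).add (HasDerivAt.fun_sum fun k _ => ?_)
    have h2 : HasFDerivAt (fun u => fderiv ℝ (c k x₀) u) (fderiv ℝ (fun u => fderiv ℝ (c k x₀) u)
        (y x₀)) (y x₀ + (0 : ℝ) • v) := by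
      simpa using ((hCd k).differentiable one_ne_zero (y x₀)).hasFDerivAt
    have h3 : HasDerivAt (fun t : ℝ => fderiv ℝ (c k x₀) (y x₀ + t • v)) _ 0 :=
      h2.comp_hasDerivAt 0 hy
    simpa using ((hasDerivAt_id (0 : ℝ)).mul_const (a k)).fun_smul h3
  have hzero : fderiv ℝ S (y x₀) v + ∑ k, a k • fderiv ℝ (c k x₀) (y x₀) = 0 := by
    refine hsum.unique (hcomp.fst.congr_of_eventuallyEq (Eventually.of_forall fun t => ?_))
    simp [hS, kktMap, add_smul, Finset.sum_add_distrib, add_assoc]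
  have hvv : fderiv ℝ S (y x₀) v v = 0 := by
    have h1 := DFunLike.congr_fun hzero v
    have h2 : ∑ k, a k * fderiv ℝ (c k x₀) (y x₀) v = 0 := Finset.sum_eq_zero fun k _ => by
      by_cases hk : k ∈ A
      · rw [hact k hk, mul_zero]
      · rw [hinact k hk, zero_mul]
    simpa only [add_apply, sum_apply, smul_apply, smul_eq_mul, h2, add_zero, zero_apply] using h1
  have hv0 : v = 0 := by
    rw [hvv] at hcoer
    have : ‖v‖ ^ 2 ≤ 0 := nonpos_of_mul_nonpos_right hcoer h.pos
    exact norm_eq_zero.1 (pow_eq_zero_iff two_ne_zero |>.1 (le_antisymm this (sq_nonneg _)))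
  have ha0 : ∑ k, |a k| ≤ 0 := by
    obtain ⟨M, -, hM⟩ := h.eventually_sum_abs_le x₀
    have h1 := hM.self_of_nhds a fun k hk => hinact k (by simpa [hA] using hk)
    rw [hv0, map_zero, zero_add] at hzero
    simpa [hzero] using h1
  have ha : a = 0 := by
    funext k
    exact abs_nonpos_iff.1 ((Finset.single_le_sum (f := fun k => |a k|)
      (fun k _ => abs_nonneg (a k)) (Finset.mem_univ k)).trans ha0)
  rw [hv0, ha, Prod.mk_zero_zero]

/-- If the active constraints stay active nearby, the KKT point depends on the parameter in a
continuously differentiable way. -/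
theorem contDiffAt_of_eventually_active [FiniteDimensional ℝ E] [FiniteDimensional ℝ F]
    (h : IsKKTFamily g c μ y w) (x₀ : E)
    (hact : ∀ᶠ x in 𝓝 x₀, ∀ k, c k x₀ (y x₀) = 0 → c k x (y x) = 0) :
    ContDiffAt ℝ 1 y x₀ := by
  classical
  have : CompleteSpace E := FiniteDimensional.complete ℝ E
  have : CompleteSpace F := FiniteDimensional.complete ℝ F
  set A : Set ι := {k | c k x₀ (y x₀) = 0} with hA
  set u : E × F × (ι → ℝ) := (x₀, y x₀, w x₀) with hu
  have hcd : ContDiffAt ℝ 1 (kktMap g c A) u := (h.contDiff_kktMap A).contDiffAt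
  have hfr : Module.finrank ℝ (F × (ι → ℝ)) = Module.finrank ℝ ((F →L[ℝ] ℝ) × (ι → ℝ)) := by
    rw [Module.finrank_prod, Module.finrank_prod,
      ← (LinearMap.toContinuousLinearMap (𝕜 := ℝ) (E := F) (F' := ℝ)).finrank_eq]
    congr 1
    exact Subspace.dual_finrank_eq.symm
  have hinv : (fderiv ℝ (kktMap g c A) u ∘L
      ContinuousLinearMap.inr ℝ E (F × (ι → ℝ))).IsInvertible := by
    refine ⟨(LinearMap.linearEquivOfInjective _ (h.kktMap_injective x₀ A hA)
      hfr).toContinuousLinearEquiv, ?_⟩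
    ext z <;> rfl
  have hsol : ∀ᶠ x in 𝓝 x₀, kktMap g c A (x, y x, w x) = 0 := by
    filter_upwards [hact, h.eventually_mult_eq_zero x₀] with x hx hx0
    refine Prod.ext (h.stationary x) (funext fun k => ?_)
    by_cases hk : k ∈ A
    · simpa [kktMap, hk] using hx k hk
    · simpa [kktMap, hk] using hx0 k hk
  have hcont : ContinuousAt (fun x => (x, y x, w x)) x₀ :=
    continuousAt_id.prodMk ((h.continuousAt x₀).prodMk
      (continuousAt_pi.2 fun k => (h.locallyLipschitz_mult k).continuous.continuousAt))
  have hψ : ∀ᶠ x in 𝓝 x₀, y x = (hcd.implicitFunction one_ne_zero hinv x).1 := by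
    have hu0 : kktMap g c A u = 0 := hsol.self_of_nhds
    filter_upwards [hsol, hcont.eventually
      (hcd.eventually_apply_eq_iff_implicitFunction one_ne_zero hinv)] with x hx hx'
    rw [hx'.1 (hx.trans hu0.symm)]
  exact (hcd.contDiffAt_implicitFunction one_ne_zero hinv).fst.congr_of_eventuallyEq hψ

end IsKKTFamily

/-- (Proposition 3 of the paper.) Under Assumptions 1, 2, 3 and with
`Φ(x) = f(x, y*(x))`: (i) `Φ`, each `λ_j(·)`, and each `x ↦ p_j(x, y*(x))` admit
Lipschitz constants on the closed ball `B(x⁰, ε)`; (ii) if the SCSC holds at `y*(x⁰)`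
and for some `ε₁ > 0` and Lipschitz constants `l_{λ_j}, l_{p_j}` on `B(x⁰, ε₁)` we have
`λ_j(x⁰) > l_{λ_j}·ε₁` for all active `j` and `p_j(x⁰, y*(x⁰)) < −l_{p_j}·ε₁` for all
inactive `j`, then `y*` is continuously differentiable on `B(x⁰, ε₁)`. -/
theorem stmt_9 (dx dy m n : ℕ)
    (f : EuclideanSpace ℝ (Fin dx) → EuclideanSpace ℝ (Fin dy) → ℝ)
    (g : EuclideanSpace ℝ (Fin dx) → EuclideanSpace ℝ (Fin dy) → ℝ)
    (p : Fin m → EuclideanSpace ℝ (Fin dx) → EuclideanSpace ℝ (Fin dy) → ℝ)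
    (q : Fin n → EuclideanSpace ℝ (Fin dx) → EuclideanSpace ℝ (Fin dy) → ℝ)
    -- Assumption 1
    (hf2 : ContDiff ℝ 2 fun xy : EuclideanSpace ℝ (Fin dx) × EuclideanSpace ℝ (Fin dy) =>
      f xy.1 xy.2)
    (hg2 : ContDiff ℝ 2 fun xy : EuclideanSpace ℝ (Fin dx) × EuclideanSpace ℝ (Fin dy) =>
      g xy.1 xy.2)
    (hp2 : ∀ j, ContDiff ℝ 2
      fun xy : EuclideanSpace ℝ (Fin dx) × EuclideanSpace ℝ (Fin dy) => p j xy.1 xy.2)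
    (hq2 : ∀ i, ContDiff ℝ 2
      fun xy : EuclideanSpace ℝ (Fin dx) × EuclideanSpace ℝ (Fin dy) => q i xy.1 xy.2)
    -- Assumption 2
    (μ : ℝ) (hμ : 0 < μ)
    (hstrong : ∀ x, ConvexOn ℝ Set.univ fun y => g x y - μ / 2 * ‖y‖ ^ 2)
    (hpconv : ∀ j x, ConvexOn ℝ Set.univ (p j x))
    (hqaff : ∀ i x, ∃ (a : EuclideanSpace ℝ (Fin dy) →L[ℝ] ℝ) (c : ℝ),
      ∀ y, q i x y = a y + c)
    -- y*(x), λ(x), ν(x): the global minimizer and KKT multipliers of P(x)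
    (ystar : EuclideanSpace ℝ (Fin dx) → EuclideanSpace ℝ (Fin dy))
    (lam : EuclideanSpace ℝ (Fin dx) → Fin m → ℝ)
    (nu : EuclideanSpace ℝ (Fin dx) → Fin n → ℝ)
    (hfeas : ∀ x, (∀ j, p j x (ystar x) ≤ 0) ∧ ∀ i, q i x (ystar x) = 0)
    (hmin : ∀ x y, (∀ j, p j x y ≤ 0) → (∀ i, q i x y = 0) → g x (ystar x) ≤ g x y)
    (hKKT : ∀ x, gradient (g x) (ystar x) + ∑ j, lam x j • gradient (p j x) (ystar x)
      + ∑ i, nu x i • gradient (q i x) (ystar x) = 0)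
    (hlamnn : ∀ x j, 0 ≤ lam x j)
    (hcomp : ∀ x j, lam x j * p j x (ystar x) = 0)
    -- Assumption 3: LICQ at y*(x)
    (hLICQ : ∀ x, LinearIndependent ℝ (Sum.elim
      (fun j : {j : Fin m // p j x (ystar x) = 0} => gradient (p j.1 x) (ystar x))
      (fun i : Fin n => gradient (q i x) (ystar x))))
    (x0 : EuclideanSpace ℝ (Fin dx)) (ε : ℝ) (hε : 0 < ε) :
    -- (i) Lipschitz constants on B(x⁰, ε) exist
    ((∃ lΦ : NNReal, LipschitzOnWith lΦ (fun x => f x (ystar x))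
        (Metric.closedBall x0 ε)) ∧
      (∀ j : Fin m, ∃ llam : NNReal, LipschitzOnWith llam (fun x => lam x j)
        (Metric.closedBall x0 ε)) ∧
      (∀ j : Fin m, ∃ lp : NNReal, LipschitzOnWith lp (fun x => p j x (ystar x))
        (Metric.closedBall x0 ε))) ∧
    -- (ii) the differentiability criterion
    ((∀ j, p j x0 (ystar x0) = 0 → 0 < lam x0 j) →  -- SCSC at y*(x⁰) w.r.t. λ(x⁰)
      ∀ ε₁ : ℝ, 0 < ε₁ → ∀ llam lp : Fin m → NNReal,
      (∀ j, LipschitzOnWith (llam j) (fun x => lam x j) (Metric.closedBall x0 ε₁)) →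
      (∀ j, LipschitzOnWith (lp j) (fun x => p j x (ystar x)) (Metric.closedBall x0 ε₁)) →
      (∀ j, p j x0 (ystar x0) = 0 → (llam j : ℝ) * ε₁ < lam x0 j) →
      (∀ j, p j x0 (ystar x0) ≠ 0 → p j x0 (ystar x0) < -((lp j : ℝ) * ε₁)) →
      ContDiffOn ℝ 1 ystar (Metric.closedBall x0 ε₁)) := by
  have hcoe : ∀ (φ : EuclideanSpace ℝ (Fin dy) → ℝ) (u : EuclideanSpace ℝ (Fin dy)),
      InnerProductSpace.toDual ℝ _ (gradient φ u) = fderiv ℝ φ u := fun φ u => by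
    simp [gradient]
  have hslice : ∀ {φ : EuclideanSpace ℝ (Fin dx) → EuclideanSpace ℝ (Fin dy) → ℝ},
      ContDiff ℝ 2 (fun xy : EuclideanSpace ℝ (Fin dx) × EuclideanSpace ℝ (Fin dy) =>
        φ xy.1 xy.2) → ∀ x, Differentiable ℝ (φ x) := fun hφ x =>
    (hφ.comp (contDiff_const.prodMk contDiff_id)).differentiable (by norm_num)
  have H : IsKKTFamily g (Sum.elim p q) μ ystar fun x => Sum.elim (lam x) (nu x) :=
    { contDiff_obj := hg2
      contDiff_con := by
        rintro (j | i)
        exacts [hp2 j, hq2 i]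
      pos := hμ
      obj_lower := fun x u v => (hstrong x).add_half_mul_sq_le (hslice hg2 x u) v
      con_lower := by
        rintro x x' (j | i) u v
        · refine mul_le_mul_of_nonneg_left ?_ (hlamnn x' j)
          have := (hpconv j x).add_fderiv_le (hslice (hp2 j) x u) v
          simp only [Sum.elim_inl]
          linarith
        · obtain ⟨a, b, hab⟩ := hqaff i x
          have hfd : fderiv ℝ (q i x) u = a := by
            rw [show q i x = fun y => a y + b from funext hab, fderiv_add_const]
            exact a.fderiv
          simp [hfd, hab]
      stationary := fun x => by
        have := congrArg (InnerProductSpace.toDual ℝ _) (hKKT x)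
        simp only [map_add, map_sum, map_zero, map_smulₛₗ, hcoe] at this
        simpa [← add_assoc] using this
      compl := by
        rintro x (j | i)
        · exact hcomp x j
        · simp [(hfeas x).2 i]
      cross := by
        rintro x x' (j | i)
        · exact mul_nonpos_of_nonneg_of_nonpos (hlamnn x j) ((hfeas x').1 j)
        · simp [(hfeas x').2 i]
      licq := fun x => by
        have hli := (hLICQ x).map' (InnerProductSpace.toDual ℝ
          (EuclideanSpace ℝ (Fin dy))).toLinearEquiv.toLinearMap (LinearEquiv.ker _)
        let σ : {k | Sum.elim p q k x (ystar x) = 0} →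
            {j : Fin m // p j x (ystar x) = 0} ⊕ Fin n := fun k =>
          match k with
          | ⟨Sum.inl j, hj⟩ => Sum.inl ⟨j, hj⟩
          | ⟨Sum.inr i, _⟩ => Sum.inr i
        have hσ : Function.Injective σ := by
          rintro ⟨j | i, h1⟩ ⟨j' | i', h2⟩ heq
          · obtain rfl : j = j' := congrArg Subtype.val (Sum.inl.inj heq)
            rfl
          · exact absurd heq Sum.inl_ne_inr
          · exact absurd heq Sum.inr_ne_inl
          · obtain rfl : i = i' := Sum.inr.inj heq
            rfl
        have hcomp := hli.comp σ hσ
        refine (linearIndependent_equiv' (Equiv.refl _) ?_).1 hcomp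
        funext ⟨k, hk⟩
        rcases k with j | i
        · exact (hcoe _ _).symm
        · exact (hcoe _ _).symm }
  have hball := fun r : ℝ => isCompact_closedBall x0 r
  refine ⟨⟨?_, fun j => ?_, fun j => ?_⟩, ?_⟩
  · exact ((H.locallyLipschitz.comp_graph (hf2.of_le (by norm_num))).locallyLipschitzOn
      ).exists_lipschitzOnWith_of_compact (hball ε)
  · exact ((H.locallyLipschitz_mult (Sum.inl j)).locallyLipschitzOn
      ).exists_lipschitzOnWith_of_compact (hball ε)
  · exact ((H.locallyLipschitz.comp_graph ((hp2 j).of_le (by norm_num))).locallyLipschitzOn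
      ).exists_lipschitzOnWith_of_compact (hball ε)
  · intro _ ε₁ hε₁ llam lp hllam hlp hact hinact x hx
    refine (H.contDiffAt_of_eventually_active x ?_).contDiffWithinAt
    have hx0 : x0 ∈ Metric.closedBall x0 ε₁ := Metric.mem_closedBall_self hε₁.le
    have hdist : dist x x0 ≤ ε₁ := hx
    refine eventually_all.2 ?_
    rintro (j | i)
    · by_cases hj : p j x (ystar x) = 0
      · have hj0 : p j x0 (ystar x0) = 0 := by
          by_contra hne
          have h1 := (hlp j).dist_le_mul x hx x0 hx0
          have h2 := hinact j hne
          have h3 : (lp j : ℝ) * dist x x0 ≤ lp j * ε₁ := by gcongr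
          rw [Real.dist_eq, hj] at h1
          linarith [le_abs_self (0 - p j x0 (ystar x0))]
        have hpos : 0 < lam x j := by
          have h1 := (hllam j).dist_le_mul x hx x0 hx0
          have h2 := hact j hj0
          have h3 : (llam j : ℝ) * dist x x0 ≤ llam j * ε₁ := by gcongr
          rw [Real.dist_eq] at h1
          linarith [neg_abs_le (lam x j - lam x0 j)]
        have hev := (H.locallyLipschitz_mult (Sum.inl j)).continuous.continuousAt.eventually_const_lt
          (show (0 : ℝ) < Sum.elim (lam x) (nu x) (Sum.inl j) from hpos)
        exact hev.mono fun x' hx' _ => (mul_eq_zero.1 (hcomp x' j)).resolve_left hx'.ne'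
      · exact Eventually.of_forall fun _ h0 => absurd h0 hj
    · exact Eventually.of_forall fun x' _ => (hfeas x').2 i
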